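/- Let A' ⊆ A be agendas. Then the set of preference profiles on A that are strongly regular on A' has affine dimension |A|! − C(|A'|,2) − 1, where C(|A'|,2) is the binomial coefficient. -/

import Mathlib

open Finset

namespace PSC

/-- `r` is a linear order (complete, transitive, antisymmetric; as a set of pairs) on `A`. -/
def IsLinearOrderOn (A : Finset ℕ) (r : Finset (ℕ × ℕ)) : Prop :=
  r ⊆ A ×ˢ A ∧ (∀ x ∈ A, (x, x) ∈ r) ∧
    (∀ x ∈ A, ∀ y ∈ A, (x, y) ∈ r ∨ (y, x) ∈ r) ∧
    (∀ x y z : ℕ, (x, y) ∈ r → (y, z) ∈ r → (x, z) ∈ r) ∧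
    (∀ x y : ℕ, (x, y) ∈ r → (y, x) ∈ r → x = y)

open Classical in
/-- The set `L(A)` of linear orders on the agenda `A`. -/
noncomputable def linOrders (A : Finset ℕ) : Finset (Finset (ℕ × ℕ)) :=
  (A ×ˢ A).powerset.filter (fun r => IsLinearOrderOn A r)

/-- `R` is a (fractional) preference profile on the agenda `A`. -/
def IsProfile (A : Finset ℕ) (R : Finset (ℕ × ℕ) → ℚ) : Prop :=
  (∀ r, r ∉ linOrders A → R r = 0) ∧ (∀ r, 0 ≤ R r) ∧ (∑ r ∈ linOrders A, R r) = 1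

open Classical in
/-- `R(x,y)`: the total weight of orders ranking `x` strictly above `y`. -/
noncomputable def pref (A : Finset ℕ) (R : Finset (ℕ × ℕ) → ℚ) (x y : ℕ) : ℚ :=
  ∑ r ∈ (linOrders A).filter (fun r => (x, y) ∈ r ∧ (y, x) ∉ r), R r

/-- The majority margin `M_R(x,y) = R(x,y) - R(y,x)`. -/
noncomputable def margin (A : Finset ℕ) (R : Finset (ℕ × ℕ) → ℚ) (x y : ℕ) : ℚ :=
  pref A R x y - pref A R y x

/-- `p` is a lottery on `A`. -/
def IsLottery (A : Finset ℕ) (p : ℕ → ℚ) : Prop :=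
  (∀ x, x ∉ A → p x = 0) ∧ (∀ x, 0 ≤ p x) ∧ (∑ x ∈ A, p x) = 1

/-- `Δ(A)`, the set of lotteries on `A`. -/
def lotteries (A : Finset ℕ) : Set (ℕ → ℚ) := {p | IsLottery A p}

/-- 1-norm distance between two profiles on `A`. -/
noncomputable def profileDist (A : Finset ℕ) (R R' : Finset (ℕ × ℕ) → ℚ) : ℚ :=
  ∑ r ∈ linOrders A, |R r - R' r|

/-- 1-norm distance between two lotteries on `A`. -/
noncomputable def lotteryDist (A : Finset ℕ) (p q : ℕ → ℚ) : ℚ :=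
  ∑ x ∈ A, |p x - q x|

/-- Restriction of an order to `B`. -/
def restrictOrder (B : Finset ℕ) (r : Finset (ℕ × ℕ)) : Finset (ℕ × ℕ) := r ∩ B ×ˢ B

open Classical in
/-- The restriction `R|_B` of a profile on `A` to `B`. -/
noncomputable def restrictProfile (A B : Finset ℕ) (R : Finset (ℕ × ℕ) → ℚ) :
    Finset (ℕ × ℕ) → ℚ :=
  fun s => ∑ r ∈ (linOrders A).filter (fun r => restrictOrder B r = s), R r

/-- `B` is a component in the profile `R` on `A`. -/
def IsComponent (A B : Finset ℕ) (R : Finset (ℕ × ℕ) → ℚ) : Prop :=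
  B ⊆ A ∧ ∀ a ∈ A \ B, ∀ b ∈ B, ∀ b' ∈ B, ∀ r ∈ linOrders A, 0 < R r →
    ((a, b) ∈ r ↔ (a, b') ∈ r)

/-- The composed lottery `p ×_b q` (where `B` is the component). -/
def compLottery (B : Finset ℕ) (b : ℕ) (p q : ℕ → ℚ) : ℕ → ℚ :=
  fun x => if x ∈ B then p b * q x else p x

/-- `X ×_b Y` for sets of lotteries. -/
def compSet (B : Finset ℕ) (b : ℕ) (X Y : Set (ℕ → ℚ)) : Set (ℕ → ℚ) :=
  {pr | ∃ p ∈ X, ∃ q ∈ Y, pr = compLottery B b p q}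

/-- A probabilistic social choice function: to every (finite nonempty) agenda `A ⊆ ℕ` and
every profile on `A` it assigns a nonempty convex set of lotteries on `A`; it is upper
hemi-continuous and satisfies unanimity and decisiveness. -/
structure PSCF where
  choice : Finset ℕ → (Finset (ℕ × ℕ) → ℚ) → Set (ℕ → ℚ)
  nonempty : ∀ A : Finset ℕ, A.Nonempty → ∀ R, IsProfile A R → (choice A R).Nonempty
  subset_lotteries : ∀ A : Finset ℕ, A.Nonempty → ∀ R, IsProfile A R →
    choice A R ⊆ lotteries A
  convex : ∀ A : Finset ℕ, A.Nonempty → ∀ R, IsProfile A R →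
    ∀ p ∈ choice A R, ∀ q ∈ choice A R, ∀ t : ℚ, 0 ≤ t → t ≤ 1 →
      (fun x => t * p x + (1 - t) * q x) ∈ choice A R
  continuity : ∀ A : Finset ℕ, A.Nonempty → ∀ R, IsProfile A R → ∀ ε : ℚ, 0 < ε →
    ∃ δ : ℚ, 0 < δ ∧ ∀ R', IsProfile A R' → profileDist A R R' < δ →
      ∀ p ∈ choice A R', ∃ q ∈ choice A R, lotteryDist A p q < ε
  unanimity : ∀ x y : ℕ, ∀ R, IsProfile {x, y} R → pref {x, y} R x y = 1 →
    choice {x, y} R = {fun z => if z = x then 1 else 0}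
  decisive : ∀ A : Finset ℕ, A.Nonempty → ∀ R, IsProfile A R → ∀ ε : ℚ, 0 < ε →
    ∃ R', IsProfile A R' ∧ profileDist A R R' < ε ∧ ∃ p, choice A R' = {p}

/-- Population-consistency. -/
def PopulationConsistent (f : PSCF) : Prop :=
  ∀ A : Finset ℕ, A.Nonempty → ∀ R' R'', IsProfile A R' → IsProfile A R'' →
    ∀ l : ℚ, 0 ≤ l → l ≤ 1 →
      f.choice A R' ∩ f.choice A R'' ⊆ f.choice A (fun r => l * R' r + (1 - l) * R'' r)

/-- Composition-consistency. -/
def CompositionConsistent (f : PSCF) : Prop :=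
  ∀ A' B : Finset ℕ, ∀ b : ℕ, A' ∩ B = {b} →
    ∀ R, IsProfile (A' ∪ B) R → IsComponent (A' ∪ B) B R →
      f.choice (A' ∪ B) R =
        compSet B b (f.choice A' (restrictProfile (A' ∪ B) A' R))
          (f.choice B (restrictProfile (A' ∪ B) B R))

/-- The maximal-lotteries correspondence. -/
noncomputable def ML (A : Finset ℕ) (R : Finset (ℕ × ℕ) → ℚ) : Set (ℕ → ℚ) :=
  {p | IsLottery A p ∧ ∀ q, IsLottery A q →
    0 ≤ ∑ x ∈ A, ∑ y ∈ A, p x * margin A R x y * q y}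

/-- The uniform profile `uni(L(A))` on `A`. -/
noncomputable def uniProfile (A : Finset ℕ) : Finset (ℕ × ℕ) → ℚ :=
  fun r => if r ∈ linOrders A then ((Nat.factorial A.card : ℕ) : ℚ)⁻¹ else 0

/-- The uniform lottery `uni(A)` on `A`. -/
def uniLottery (A : Finset ℕ) : ℕ → ℚ :=
  fun x => if x ∈ A then (A.card : ℚ)⁻¹ else 0

/-- The degenerate lottery on `x`. -/
def degLottery (x : ℕ) : ℕ → ℚ := fun z => if z = x then 1 else 0

/-- `x` is a (weak) Condorcet winner in `R`. -/
def IsCondorcetWinner (A : Finset ℕ) (R : Finset (ℕ × ℕ) → ℚ) (x : ℕ) : Prop :=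
  x ∈ A ∧ ∀ y ∈ A, 0 ≤ margin A R x y

/-- `R` is regular on `A'`. -/
def Regular (A A' : Finset ℕ) (R : Finset (ℕ × ℕ) → ℚ) : Prop :=
  ∀ x ∈ A', (∑ y ∈ A', margin A R x y) = 0

/-- `R` is strongly regular on `A'`. -/
def StronglyRegular (A A' : Finset ℕ) (R : Finset (ℕ × ℕ) → ℚ) : Prop :=
  ∀ x ∈ A', ∀ y ∈ A', margin A R x y = 0

/-- Image of an order under a renaming `π`. -/
def mapOrder (π : ℕ → ℕ) (r : Finset (ℕ × ℕ)) : Finset (ℕ × ℕ) :=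
  r.image (fun xy => (π xy.1, π xy.2))

open Classical in
/-- The image `π(R)` of a profile on `A` under a renaming `π`. -/
noncomputable def mapProfile (π : ℕ → ℕ) (A : Finset ℕ) (R : Finset (ℕ × ℕ) → ℚ) :
    Finset (ℕ × ℕ) → ℚ :=
  fun s => ∑ r ∈ (linOrders A).filter (fun r => mapOrder π r = s), R r

open Classical in
/-- The image `π(p)` of a lottery on `A` under a renaming `π`. -/
noncomputable def mapLottery (π : ℕ → ℕ) (A : Finset ℕ) (p : ℕ → ℚ) : ℕ → ℚ :=
  fun y => ∑ x ∈ A.filter (fun x => π x = y), p x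

/-- The bound `ε_n = (4^n · ∏_{k=1}^n k!)⁻¹`. -/
noncomputable def epsN (n : ℕ) : ℚ :=
  (((4 ^ n * ∏ k ∈ Finset.Icc 1 n, Nat.factorial k : ℕ) : ℚ))⁻¹

noncomputable def sgn (r : Finset (ℕ × ℕ)) (x y : ℕ) : ℚ :=
  (if (x, y) ∈ r ∧ (y, x) ∉ r then 1 else 0) - (if (y, x) ∈ r ∧ (x, y) ∉ r then 1 else 0)

lemma mem_linOrders {A : Finset ℕ} {r : Finset (ℕ × ℕ)} :
    r ∈ linOrders A ↔ IsLinearOrderOn A r := by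
  unfold linOrders
  simp only [mem_filter, mem_powerset]
  exact ⟨fun h => h.2, fun h => ⟨h.1, h⟩⟩

lemma margin_eq (A : Finset ℕ) (R : Finset (ℕ × ℕ) → ℚ) (x y : ℕ) :
    margin A R x y = ∑ r ∈ linOrders A, R r * sgn r x y := by
  unfold margin pref sgn
  rw [sum_filter, sum_filter, ← sum_sub_distrib]
  refine sum_congr rfl fun r _ => ?_
  rw [mul_sub]
  congr 1 <;> simp

lemma sgn_self (r : Finset (ℕ × ℕ)) (x : ℕ) : sgn r x x = 0 := by simp [sgn]

lemma sgn_swap (r : Finset (ℕ × ℕ)) (x y : ℕ) : sgn r y x = - sgn r x y := by simp [sgn]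

def rev (r : Finset (ℕ × ℕ)) : Finset (ℕ × ℕ) := r.image Prod.swap

lemma mem_rev {r : Finset (ℕ × ℕ)} {x y : ℕ} : (x, y) ∈ rev r ↔ (y, x) ∈ r := by
  simp only [rev, mem_image, Prod.exists, Prod.swap_prod_mk, Prod.mk.injEq]
  constructor
  · rintro ⟨a, b, h, rfl, rfl⟩; exact h
  · intro h; exact ⟨y, x, h, rfl, rfl⟩

lemma rev_rev (r : Finset (ℕ × ℕ)) : rev (rev r) = r := by
  ext ⟨x, y⟩; rw [mem_rev, mem_rev]

lemma rev_mem {A : Finset ℕ} {r : Finset (ℕ × ℕ)} (h : r ∈ linOrders A) :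
    rev r ∈ linOrders A := by
  rw [mem_linOrders] at h ⊢
  obtain ⟨h1, h2, h3, h4, h5⟩ := h
  refine ⟨?_, ?_, ?_, ?_, ?_⟩
  · rintro ⟨x, y⟩ hxy
    have := h1 (mem_rev.1 hxy)
    simp only [mem_product] at this ⊢
    exact ⟨this.2, this.1⟩
  · intro x hx; exact mem_rev.2 (h2 x hx)
  · intro x hx y hy; rw [mem_rev, mem_rev]; exact h3 y hy x hx
  · intro x y z; rw [mem_rev, mem_rev, mem_rev]; exact fun a b => h4 _ _ _ b a
  · intro x y; rw [mem_rev, mem_rev]; exact fun a b => h5 _ _ b a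

lemma sgn_rev (r : Finset (ℕ × ℕ)) (x y : ℕ) : sgn (rev r) x y = - sgn r x y := by
  simp [sgn, mem_rev]

lemma sum_sgn (A : Finset ℕ) (x y : ℕ) : ∑ r ∈ linOrders A, sgn r x y = 0 := by
  have h : ∑ r ∈ linOrders A, sgn r x y = ∑ r ∈ linOrders A, - sgn r x y :=
    sum_nbij' rev rev (fun _ h => rev_mem h) (fun _ h => rev_mem h)
      (fun r _ => rev_rev r) (fun r _ => rev_rev r) (fun r _ => by rw [sgn_rev, neg_neg])
  rw [sum_neg_distrib] at h
  linarith

/-- order on `A` induced by a function -/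
noncomputable def ord (A : Finset ℕ) (f : ℕ → ℕ) : Finset (ℕ × ℕ) :=
  (A ×ˢ A).filter (fun p => f p.1 ≤ f p.2)

lemma mem_ord {A : Finset ℕ} {f : ℕ → ℕ} {x y : ℕ} :
    (x, y) ∈ ord A f ↔ (x ∈ A ∧ y ∈ A) ∧ f x ≤ f y := by
  simp [ord]

lemma ord_mem {A : Finset ℕ} {f : ℕ → ℕ} (hf : Set.InjOn f A) : ord A f ∈ linOrders A := by
  rw [mem_linOrders]
  refine ⟨filter_subset _ _, ?_, ?_, ?_, ?_⟩
  · intro x hx; simp [mem_ord, hx]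
  · intro x hx y hy; simp only [mem_ord, hx, hy, true_and, and_self]; exact le_total _ _
  · intro x y z; simp only [mem_ord]; rintro ⟨⟨a, b⟩, c⟩ ⟨⟨d, e⟩, g⟩
    exact ⟨⟨a, e⟩, c.trans g⟩
  · intro x y; simp only [mem_ord]; rintro ⟨⟨a, b⟩, c⟩ ⟨⟨d, e⟩, g⟩
    exact hf a b (le_antisymm c g)

lemma sgn_ord {A : Finset ℕ} {f : ℕ → ℕ} {x y : ℕ} (hx : x ∈ A) (hy : y ∈ A) :
    sgn (ord A f) x y = (if f x < f y then 1 else 0) - (if f y < f x then 1 else 0) := by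
  simp only [sgn, mem_ord, hx, hy, true_and, and_self, not_le]
  congr 1 <;> congr 1 <;> simp <;> exact le_of_lt

noncomputable def toOrd (A : Finset ℕ) (e : A ≃ Fin A.card) : linOrders A :=
  ⟨ord A (fun z => if h : z ∈ A then (e ⟨z, h⟩ : ℕ) else 0), ord_mem (by
    intro x hx y hy h
    have hx' : x ∈ A := hx
    have hy' : y ∈ A := hy
    simp only [hx', hy', dif_pos] at h
    simpa using e.injective (Fin.ext h))⟩

lemma mem_toOrd {A : Finset ℕ} {e : A ≃ Fin A.card} (x y : A) :
    ((x : ℕ), (y : ℕ)) ∈ (toOrd A e).1 ↔ e x ≤ e y := by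
  simp [toOrd, mem_ord]

lemma toOrd_inj (A : Finset ℕ) : Function.Injective (toOrd A) := by
  intro e e' h
  have key : ∀ x y, e x ≤ e y ↔ e' x ≤ e' y := fun x y => by
    rw [← mem_toOrd, ← mem_toOrd, h]
  let φ : Fin A.card ≃o Fin A.card :=
    ⟨e.symm.trans e', by intro a b; simp [← key]⟩
  have hφ : φ = OrderIso.refl _ := Subsingleton.elim _ _
  ext x
  have := congrArg (fun ψ : Fin A.card ≃o Fin A.card => ψ (e x)) hφ
  simp [φ] at this
  exact congrArg Fin.val this.symm

lemma exists_rank {α : Type*} [Fintype α] {n : ℕ} (hn : Fintype.card α = n) (r : α → α → Prop)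
    (h2 : ∀ x, r x x) (h3 : ∀ x y, r x y ∨ r y x) (h4 : ∀ x y z, r x y → r y z → r x z)
    (h5 : ∀ x y, r x y → r y x → x = y) : ∃ e : α ≃ Fin n, ∀ x y, e x ≤ e y ↔ r x y := by
  let inst : LinearOrder α :=
    { le := r
      le_refl := h2
      le_trans := h4
      le_antisymm := h5
      le_total := h3
      toDecidableLE := Classical.decRel _ }
  let φ := Fintype.orderIsoFinOfCardEq α hn
  exact ⟨φ.symm.toEquiv, fun x y => φ.symm.le_iff_le⟩

lemma toOrd_surj (A : Finset ℕ) : Function.Surjective (toOrd A) := by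
  rintro ⟨r, hr⟩
  obtain ⟨h1, h2, h3, h4, h5⟩ := mem_linOrders.1 hr
  obtain ⟨e, he⟩ := exists_rank (Fintype.card_coe A)
    (fun x y : A => ((x : ℕ), (y : ℕ)) ∈ r) (fun x => h2 x x.2) (fun x y => h3 x x.2 y y.2)
    (fun x y z => h4 x y z) (fun x y a b => Subtype.ext (h5 x y a b))
  refine ⟨e, Subtype.ext ?_⟩
  ext ⟨x, y⟩
  by_cases hxy : x ∈ A ∧ y ∈ A
  · exact (mem_toOrd (e := e) ⟨x, hxy.1⟩ ⟨y, hxy.2⟩).trans (he _ _)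
  · constructor
    · intro h
      exact absurd (mem_ord.1 h).1 hxy
    · intro h
      exact absurd (by simpa using h1 h) hxy

lemma card_linOrders (A : Finset ℕ) : (linOrders A).card = Nat.factorial A.card := by
  rw [← Fintype.card_coe, ← Fintype.card_of_bijective ⟨toOrd_inj A, toOrd_surj A⟩,
    Fintype.card_equiv (Fintype.equivFinOfCardEq (Fintype.card_coe A)), Fintype.card_coe]

def pairs (B : Finset ℕ) : Finset (ℕ × ℕ) := (B ×ˢ B).filter (fun p => p.1 < p.2)

lemma card_pairs (B : Finset ℕ) : (pairs B).card = Nat.choose B.card 2 := by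
  have h1 : B.offDiag = pairs B ∪ (B ×ˢ B).filter (fun p => p.2 < p.1) := by
    ext ⟨x, y⟩
    simp only [mem_offDiag, pairs, mem_union, mem_filter, mem_product]
    constructor
    · rintro ⟨a, b, c⟩
      rcases lt_or_gt_of_ne c with h | h <;> simp [a, b, h]
    · rintro (⟨⟨a, b⟩, c⟩ | ⟨⟨a, b⟩, c⟩)
      · exact ⟨a, b, ne_of_lt c⟩
      · exact ⟨a, b, ne_of_gt c⟩
  have h2 : Disjoint (pairs B) ((B ×ˢ B).filter (fun p => p.2 < p.1)) := by
    rw [pairs, disjoint_filter]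
    intro p _ h; exact not_lt_of_gt h
  have h3 : (pairs B).card = ((B ×ˢ B).filter (fun p => p.2 < p.1)).card := by
    refine card_nbij' Prod.swap Prod.swap ?_ ?_ ?_ ?_ <;> intro p <;> simp [pairs] <;> tauto
  have h4 := congrArg card h1
  rw [card_union_of_disjoint h2, ← h3, offDiag_card] at h4
  rw [Nat.choose_two_right, Nat.mul_sub, mul_one]
  omega

/-- The linear map of all constraints. -/
noncomputable def T (A B : Finset ℕ) :
    (linOrders A → ℚ) →ₗ[ℚ] ℚ × (pairs B → ℚ) where
  toFun v := (∑ r, v r, fun p => ∑ r, v r * sgn r.1 p.1.1 p.1.2)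
  map_add' u v := by
    ext <;> simp [add_mul, sum_add_distrib]
  map_smul' c v := by
    ext <;> simp [mul_sum, mul_assoc]

open Classical in
noncomputable def E (A : Finset ℕ) : (linOrders A → ℚ) →ₗ[ℚ] (Finset (ℕ × ℕ) → ℚ) where
  toFun v := fun r => if h : r ∈ linOrders A then v ⟨r, h⟩ else 0
  map_add' u v := by
    ext r; by_cases h : r ∈ linOrders A <;> simp [h]
  map_smul' c v := by
    ext r; by_cases h : r ∈ linOrders A <;> simp [h]

lemma E_apply {A : Finset ℕ} (v : linOrders A → ℚ) (r : linOrders A) : E A v r.1 = v r := by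
  simp [E]

lemma E_not {A : Finset ℕ} (v : linOrders A → ℚ) {r} (h : r ∉ linOrders A) : E A v r = 0 := by
  simp [E, h]

lemma E_inj (A : Finset ℕ) : Function.Injective (E A) := by
  intro u v h
  ext r
  rw [← E_apply u, h, E_apply]

lemma T_single {A B : Finset ℕ} (r : linOrders A) :
    T A B (Pi.single r 1) = (1, fun p => sgn r.1 p.1.1 p.1.2) := by
  ext <;> simp [T, Pi.single_apply]

lemma T_pair {A B : Finset ℕ} (hB : B ⊆ A) (p : pairs B) :
    ∃ w, T A B w = (0, Pi.single p 1) := by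
  obtain ⟨⟨x, y⟩, hp⟩ := p
  have hp' := hp
  simp only [pairs, mem_filter, mem_product] at hp'
  obtain ⟨⟨hx, hy⟩, hxy⟩ := hp'
  let f : ℕ → ℕ := fun z => if z = x then 0 else if z = y then 1 else z + 2
  let g : ℕ → ℕ := fun z => if z = y then 0 else if z = x then 1 else z + 2
  have hf : Set.InjOn f A := by
    intro a _ b _ h
    simp only [f] at h
    split_ifs at h <;> omega
  have hg : Set.InjOn g A := by
    intro a _ b _ h
    simp only [g] at h
    split_ifs at h <;> omega
  refine ⟨(1 / 2 : ℚ) • (Pi.single ⟨_, ord_mem hf⟩ 1 - Pi.single ⟨_, ord_mem hg⟩ 1), ?_⟩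
  rw [map_smul, map_sub, T_single, T_single]
  refine Prod.ext (by simp) ?_
  funext q
  obtain ⟨⟨a, b⟩, hq⟩ := q
  have hq' := hq
  simp only [pairs, mem_filter, mem_product] at hq'
  obtain ⟨⟨ha, hb⟩, hab⟩ := hq'
  simp only [Prod.mk_sub_mk, Prod.smul_mk, Pi.smul_apply, Pi.sub_apply, smul_eq_mul,
    sgn_ord (hB ha) (hB hb), Pi.single_apply, Subtype.mk.injEq, Prod.mk.injEq]
  by_cases h : a = x ∧ b = y
  · obtain ⟨rfl, rfl⟩ := h
    simp [f, g, hxy.ne, hxy.ne']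
    norm_num
  · have e1 : f a < f b ↔ g a < g b := by
      simp only [f, g]; split_ifs <;> omega
    have e2 : f b < f a ↔ g b < g a := by
      simp only [f, g]; split_ifs <;> omega
    simp [h, e1, e2]

lemma T_surj {A B : Finset ℕ} (hB : B ⊆ A) : Function.Surjective (T A B) := by
  choose w hw using T_pair hB
  have h0 : ∀ d, ∃ v, T A B v = (0, d) := by
    intro d
    refine ⟨∑ p, d p • w p, ?_⟩
    rw [map_sum]
    simp only [map_smul, hw]
    refine Prod.ext (by simp [Prod.fst_sum]) ?_
    funext q
    simp [Prod.snd_sum, Pi.single_apply]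
  rintro ⟨c, d⟩
  have hid : Set.InjOn (id : ℕ → ℕ) A := Function.injective_id.injOn
  let v0 : linOrders A → ℚ := Pi.single ⟨_, ord_mem hid⟩ 1
  have hv0 : (T A B v0).1 = 1 := by simp only [v0, T_single]
  obtain ⟨v, hv⟩ := h0 (d - c • (T A B v0).2)
  refine ⟨c • v0 + v, ?_⟩
  rw [map_add, map_smul, hv]
  ext <;> simp [hv0]

lemma margin_E {A : Finset ℕ} (v : linOrders A → ℚ) (x y : ℕ) :
    margin A (E A v) x y = ∑ r, v r * sgn r.1 x y := by
  rw [margin_eq, ← sum_coe_sort]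
  exact sum_congr rfl fun r _ => by rw [E_apply]

lemma sum_E {A : Finset ℕ} (v : linOrders A → ℚ) :
    ∑ r ∈ linOrders A, E A v r = ∑ r, v r := by
  rw [← sum_coe_sort]
  exact sum_congr rfl fun r _ => by rw [E_apply]

lemma strong_iff {A B : Finset ℕ} (v : linOrders A → ℚ) :
    StronglyRegular A B (E A v) ↔ (T A B v).2 = 0 := by
  constructor
  · intro h
    funext p
    obtain ⟨⟨x, y⟩, hp⟩ := p
    have hp' := hp
    simp only [pairs, mem_filter, mem_product] at hp'
    have := h x hp'.1.1 y hp'.1.2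
    rw [margin_E] at this
    exact this
  · intro h x hx y hy
    have key : ∀ x ∈ B, ∀ y ∈ B, x < y → ∑ r, v r * sgn r.1 x y = 0 := by
      intro x hx y hy hxy
      exact congrFun h ⟨(x, y), by simp [pairs, hx, hy, hxy]⟩
    rw [margin_E]
    rcases lt_trichotomy x y with h1 | rfl | h1
    · exact key x hx y hy h1
    · simp [sgn_self]
    · have := key y hy x hx h1
      simp only [fun r => sgn_swap r y x, mul_neg, sum_neg_distrib, this, neg_zero]

lemma span_eq (A B : Finset ℕ) :
    vectorSpan ℚ {R : Finset (ℕ × ℕ) → ℚ | IsProfile A R ∧ StronglyRegular A B R} =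
      (LinearMap.ker (T A B)).map (E A) := by
  have hE : ∀ R, IsProfile A R → ∃ v, E A v = R := by
    intro R hR
    refine ⟨fun r => R r.1, ?_⟩
    funext r
    by_cases h : r ∈ linOrders A
    · exact E_apply _ ⟨r, h⟩
    · rw [E_not _ h, hR.1 r h]
  apply le_antisymm
  · rw [vectorSpan, Submodule.span_le]
    rintro _ ⟨R, ⟨hR, hR'⟩, S, ⟨hS, hS'⟩, rfl⟩
    obtain ⟨u, rfl⟩ := hE R hR
    obtain ⟨v, rfl⟩ := hE S hS
    refine ⟨u - v, ?_, by simp⟩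
    have h1 := hR.2.2
    have h2 := hS.2.2
    rw [sum_E] at h1 h2
    rw [strong_iff] at hR' hS'
    simp only [SetLike.mem_coe, LinearMap.mem_ker, map_sub]
    refine Prod.ext ?_ ?_
    · change (∑ r, u r) - ∑ r, v r = 0
      rw [h1, h2, sub_self]
    · rw [Prod.snd_sub, hR', hS', sub_zero]; rfl
  · rintro _ ⟨v, hv, rfl⟩
    have hv' : T A B v = 0 := hv
    have hv1 : ∑ r, v r = 0 := congrArg Prod.fst hv'
    have hv2 : (T A B v).2 = 0 := congrArg Prod.snd hv'
    have hN : (0 : ℚ) < (linOrders A).card := by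
      rw [card_linOrders]; exact_mod_cast Nat.factorial_pos _
    set c : ℚ := ((linOrders A).card : ℚ)⁻¹ with hc
    have hcpos : 0 < c := inv_pos.2 hN
    let u : linOrders A → ℚ := fun _ => c
    have hu1 : ∑ r, u r = 1 := by
      simp [u, hc, hN.ne']
    have hu2 : (T A B u).2 = 0 := by
      funext p
      change ∑ r : linOrders A, c * sgn r.1 p.1.1 p.1.2 = 0
      rw [← mul_sum, sum_coe_sort (linOrders A) (fun r => sgn r p.1.1 p.1.2), sum_sgn, mul_zero]
    let M : ℚ := 1 + ∑ r, |v r|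
    have hM : 0 < M := by
      have : 0 ≤ ∑ r, |v r| := sum_nonneg fun r _ => abs_nonneg _
      simp only [M]; linarith
    have hvM : ∀ r, |v r| ≤ M := by
      intro r
      have : |v r| ≤ ∑ r, |v r| :=
        single_le_sum (f := fun r => |v r|) (fun r _ => abs_nonneg _) (mem_univ r)
      simp only [M]; linarith
    have hprof : ∀ w : linOrders A → ℚ, (∀ r, 0 ≤ w r) → ∑ r, w r = 1 → (T A B w).2 = 0 →
        E A w ∈ {R : Finset (ℕ × ℕ) → ℚ | IsProfile A R ∧ StronglyRegular A B R} := by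
      intro w h0 h1 h2
      refine ⟨⟨fun r h => E_not _ h, fun r => ?_, by rw [sum_E, h1]⟩, (strong_iff w).2 h2⟩
      by_cases h : r ∈ linOrders A
      · rw [E_apply w ⟨r, h⟩]; exact h0 _
      · rw [E_not _ h]
    have m1 := hprof u (fun _ => hcpos.le) hu1 hu2
    have m2 := hprof (u + (c / M) • v) (fun r => by
        simp only [Pi.add_apply, Pi.smul_apply, smul_eq_mul, u]
        have h1 : -M ≤ v r := (abs_le.1 (hvM r)).1
        have h2 : c / M * (-M) ≤ c / M * v r := mul_le_mul_of_nonneg_left h1 (by positivity)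
        have h3 : c / M * (-M) = -c := by field_simp
        linarith)
      (by simp only [Pi.add_apply, Pi.smul_apply, smul_eq_mul, sum_add_distrib, ← mul_sum, hv1, hu1]
          simp)
      (by rw [map_add, map_smul, Prod.snd_add, Prod.smul_snd, hu2, hv2]; simp)
    have m3 := vsub_mem_vectorSpan ℚ m2 m1
    have m4 := Submodule.smul_mem _ (M / c) m3
    convert m4 using 1
    rw [vsub_eq_sub, map_add, map_smul, add_sub_cancel_left, smul_smul]
    rw [div_mul_div_comm, mul_comm M c, div_self (by positivity), one_smul]

/-- The set of profiles on `A` that are strongly regular on `A'` has affine dimension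
`|A|! - C(|A'|,2) - 1`. -/
theorem stronglyRegular_dimension (A A' : Finset ℕ) (hA' : A'.Nonempty) (hsub : A' ⊆ A) :
    Module.finrank ℚ
      ↥(vectorSpan ℚ {R : Finset (ℕ × ℕ) → ℚ | IsProfile A R ∧ StronglyRegular A A' R}) =
      Nat.factorial A.card - Nat.choose A'.card 2 - 1 := by
  rw [span_eq, ← (Submodule.equivMapOfInjective (E A) (E_inj A) _).finrank_eq]
  have h1 := LinearMap.finrank_range_add_finrank_ker (T A A')
  rw [LinearMap.range_eq_top.2 (T_surj hsub), finrank_top] at h1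
  simp only [Module.finrank_prod, Module.finrank_self, Module.finrank_fintype_fun_eq_card,
    Fintype.card_coe, card_pairs, card_linOrders] at h1
  omega

end PSC
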